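/- arXiv:2412.01586 — 3 statements merged into one kernel-verified Lean document; each statement's English description precedes it below -/
import Mathlib

section
/- Let n ≥ 1 and let A, G, W be n×n positive definite Hermitian complex matrices. Then Re(tr(G⁻¹ · W)) ≤ Re(tr(A⁻¹ · W)) · Re(tr(G⁻¹ · A)). -/
open Matrix
open scoped ComplexOrder

lemma frob_aux {n : ℕ} (X : Matrix (Fin n) (Fin n) ℂ) :
    ((Xᴴ * X).trace).re = ∑ j, ∑ i, ‖X i j‖ ^ 2 := by
  simp only [Matrix.trace, Matrix.diag, Matrix.mul_apply, Matrix.conjTranspose_apply, Complex.re_sum]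
  refine Finset.sum_congr rfl fun j _ => Finset.sum_congr rfl fun i _ => ?_
  rw [← Complex.normSq_eq_norm_sq, Complex.normSq_apply]
  simp

section
attribute [local instance] Matrix.frobeniusNormedAddCommGroup Matrix.frobeniusNormedSpace

lemma frob_norm_aux {n : ℕ} (X : Matrix (Fin n) (Fin n) ℂ) :
    ((Xᴴ * X).trace).re = ‖X‖ ^ 2 := by
  rw [frob_aux, Matrix.frobenius_norm_def, Finset.sum_comm, ← Real.sqrt_eq_rpow, Real.sq_sqrt]
  · simp
  · positivity

lemma frob_mul_aux {n : ℕ} (X Y : Matrix (Fin n) (Fin n) ℂ) :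
    (((X * Y)ᴴ * (X * Y)).trace).re ≤ ((Xᴴ * X).trace).re * ((Yᴴ * Y).trace).re := by
  simp only [frob_norm_aux]
  rw [← mul_pow]
  gcongr
  exact Matrix.frobenius_norm_mul X Y
end

lemma posdef_factor_aux {n : ℕ} {A : Matrix (Fin n) (Fin n) ℂ} (hA : A.PosDef) :
    ∃ R : Matrix (Fin n) (Fin n) ℂ, A = Rᴴ * R := by
  open scoped MatrixOrder in
  exact CStarAlgebra.nonneg_iff_eq_star_mul_self.mp hA.posSemidef.nonneg

/-- For positive definite Hermitian matrices `A`, `G`, `W`, the relative trace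
inequality `tr(G⁻¹ W) ≤ tr(A⁻¹ W) · tr(G⁻¹ A)` holds (real parts of the traces). -/
theorem relative_trace_ineq (n : ℕ) (hn : 1 ≤ n)
    (A G W : Matrix (Fin n) (Fin n) ℂ)
    (hA : A.PosDef) (hG : G.PosDef) (hW : W.PosDef) :
    ((G⁻¹ * W).trace).re ≤ ((A⁻¹ * W).trace).re * ((G⁻¹ * A).trace).re := by
  obtain ⟨R, hR⟩ := posdef_factor_aux hA
  obtain ⟨V, hV⟩ := posdef_factor_aux hW
  obtain ⟨S, hS⟩ := posdef_factor_aux hG.inv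
  have hu : IsUnit R.det := by
    have h := (Matrix.isUnit_iff_isUnit_det A).mp hA.isUnit
    rw [hR, Matrix.det_mul] at h
    exact isUnit_of_mul_isUnit_right h
  have key := frob_mul_aux (V * R⁻¹) (R * Sᴴ)
  have e0 : V * R⁻¹ * (R * Sᴴ) = V * Sᴴ := by
    rw [Matrix.mul_assoc, ← Matrix.mul_assoc R⁻¹, Matrix.nonsing_inv_mul _ hu, Matrix.one_mul]
  have e1 (V : Matrix (Fin n) (Fin n) ℂ) :
      ((V * Sᴴ)ᴴ * (V * Sᴴ)).trace = (G⁻¹ * (Vᴴ * V)).trace := by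
    rw [hS, Matrix.conjTranspose_mul, Matrix.conjTranspose_conjTranspose,
      ← Matrix.mul_assoc, Matrix.trace_mul_comm]
    simp only [Matrix.mul_assoc]
  have e2 : ((V * R⁻¹)ᴴ * (V * R⁻¹)).trace = (A⁻¹ * W).trace := by
    rw [hR, hV, Matrix.mul_inv_rev, Matrix.conjTranspose_mul, Matrix.conjTranspose_nonsing_inv,
      ← Matrix.mul_assoc, Matrix.trace_mul_comm]
    simp only [Matrix.mul_assoc]
  rw [e0, e1, e1, e2, ← hV, ← hR] at key
  exact key
end

section
/- Let (X, μ) be a measure space, n ≥ 1, and let A, G, W : X → Matrix(n, n, ℂ) be measurable maps such that A(x), G(x), W(x) are positive definite Hermitian for μ-almost every x. Assume that the functions x ↦ Re(tr(A(x)⁻¹·W(x))) · Re(det(G(x)⁻¹·A(x))) and x ↦ Re(tr(G(x)⁻¹·A(x))) are integrable. Then (∫_X √( Re(det(G(x)⁻¹·A(x))) · Re(tr(G(x)⁻¹·W(x))) ) dμ)² ≤ (∫_X Re(tr(A(x)⁻¹·W(x))) · Re(det(G(x)⁻¹·A(x))) dμ) · (∫_X Re(tr(G(x)⁻¹·A(x)))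 dμ). -/
open Matrix MeasureTheory
open scoped ComplexOrder

open scoped MatrixOrder in
theorem aux_fac {n : ℕ} {M : Matrix (Fin n) (Fin n) ℂ} (hM : M.PosSemidef) :
    ∃ D : Matrix (Fin n) (Fin n) ℂ, M = Dᴴ * D :=
  CStarAlgebra.nonneg_iff_eq_star_mul_self.mp hM.nonneg

attribute [local instance] Matrix.frobeniusNormedAddCommGroup in
theorem aux_frob {n : ℕ} (X Y : Matrix (Fin n) (Fin n) ℂ) :
    ((Xᴴ * X * (Yᴴ * Y)).trace).re = ‖X * Yᴴ‖ ^ 2 := by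
  have h : (Xᴴ * X * (Yᴴ * Y)).trace = ((X * Yᴴ)ᴴ * (X * Yᴴ)).trace := by
    rw [conjTranspose_mul, conjTranspose_conjTranspose, ← Matrix.mul_assoc,
      Matrix.trace_mul_comm]
    simp only [Matrix.mul_assoc]
  rw [h]
  generalize X * Yᴴ = M
  rw [frobenius_norm_def, ← Real.sqrt_eq_rpow, Real.sq_sqrt (by positivity)]
  simp only [Matrix.trace, Matrix.diag, Matrix.mul_apply, Complex.re_sum, conjTranspose_apply]
  rw [Finset.sum_comm]
  refine Finset.sum_congr rfl fun i _ => Finset.sum_congr rfl fun j _ => ?_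
  rw [Real.rpow_two, Complex.sq_norm, Complex.normSq_apply]
  simp

attribute [local instance] Matrix.frobeniusNormedAddCommGroup in
theorem aux_point {n : ℕ} {A G W : Matrix (Fin n) (Fin n) ℂ} (hA : A.PosDef) (hG : G.PosDef)
    (hW : W.PosDef) :
    0 ≤ ((A⁻¹ * W).trace).re ∧ 0 ≤ ((G⁻¹ * A).trace).re ∧
    ((G⁻¹ * W).trace).re ≤ ((A⁻¹ * W).trace).re * ((G⁻¹ * A).trace).re := by
  obtain ⟨D, hD⟩ : ∃ D : Matrix (Fin n) (Fin n) ℂ, G⁻¹ = Dᴴ * D :=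
    aux_fac hG.inv.posSemidef
  obtain ⟨E, hE⟩ : ∃ D : Matrix (Fin n) (Fin n) ℂ, W = Dᴴ * D :=
    aux_fac hW.posSemidef
  obtain ⟨B, hB⟩ : ∃ D : Matrix (Fin n) (Fin n) ℂ, A = Dᴴ * D :=
    aux_fac hA.posSemidef
  have hu : IsUnit B.det := by
    have h := hA.det_pos.ne'
    rw [hB, det_mul] at h
    exact (right_ne_zero_of_mul h).isUnit
  have hAi : A⁻¹ = (B⁻¹ᴴ)ᴴ * B⁻¹ᴴ := by
    rw [hB, Matrix.mul_inv_rev, conjTranspose_conjTranspose, conjTranspose_nonsing_inv]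
  have e : D * Eᴴ = D * Bᴴ * (B⁻¹ᴴ * Eᴴ) := by
    rw [Matrix.mul_assoc, ← Matrix.mul_assoc Bᴴ, ← conjTranspose_mul, nonsing_inv_mul _ hu]
    simp
  rw [hAi, hD, hE, hB, aux_frob, aux_frob, aux_frob]
  refine ⟨by positivity, by positivity, ?_⟩
  rw [e, ← mul_pow, mul_comm ‖B⁻¹ᴴ * Eᴴ‖]
  gcongr
  exact frobenius_norm_mul _ _

theorem aux_det {n : ℕ} {A G : Matrix (Fin n) (Fin n) ℂ} (hA : A.PosDef) (hG : G.PosDef) :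
    0 ≤ ((G⁻¹ * A).det).re := by
  rw [det_mul]
  exact (Complex.le_def.1 (mul_nonneg hG.inv.det_pos.le hA.det_pos.le)).1

theorem aux_cs {X : Type*} [MeasurableSpace X] {μ : Measure X} {s a b : X → ℝ}
    (ha : Integrable a μ) (hb : Integrable b μ) (ha0 : 0 ≤ᵐ[μ] a) (hb0 : 0 ≤ᵐ[μ] b)
    (h : ∀ᵐ x ∂μ, s x ≤ a x * b x) :
    (∫ x, Real.sqrt (s x) ∂μ) ^ 2 ≤ (∫ x, a x ∂μ) * ∫ x, b x ∂μ := by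
  have key : ∀ {c : X → ℝ}, Integrable c μ → 0 ≤ᵐ[μ] c →
      MemLp (fun x => Real.sqrt (c x)) 2 μ ∧ ∫ x, Real.sqrt (c x) ^ (2:ℝ) ∂μ = ∫ x, c x ∂μ := by
    intro c hc hc0
    have e : (fun x => Real.sqrt (c x) ^ 2) =ᵐ[μ] c := by
      filter_upwards [hc0] with x hx using Real.sq_sqrt hx
    refine ⟨?_, ?_⟩
    · rw [memLp_two_iff_integrable_sq
        (Real.continuous_sqrt.comp_aestronglyMeasurable hc.aestronglyMeasurable)]
      exact hc.congr e.symm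
    · simp only [Real.rpow_two]
      exact integral_congr_ae e
  obtain ⟨ma, ia⟩ := key ha ha0
  obtain ⟨mb, ib⟩ := key hb hb0
  have hol := integral_mul_le_Lp_mul_Lq_of_nonneg (μ := μ) Real.HolderConjugate.two_two
    (f := fun x => Real.sqrt (a x)) (g := fun x => Real.sqrt (b x))
    (.of_forall fun x => Real.sqrt_nonneg _) (.of_forall fun x => Real.sqrt_nonneg _)
    (by simpa using ma) (by simpa using mb)
  rw [ia, ib, ← Real.sqrt_eq_rpow, ← Real.sqrt_eq_rpow] at hol
  have hm : ∫ x, Real.sqrt (s x) ∂μ ≤ ∫ x, Real.sqrt (a x) * Real.sqrt (b x) ∂μ := by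
    refine integral_mono_of_nonneg (.of_forall fun x => Real.sqrt_nonneg _)
      (ma.integrable_mul mb) ?_
    filter_upwards [h, ha0] with x hx hx0
    rw [← Real.sqrt_mul hx0]
    exact Real.sqrt_le_sqrt hx
  calc _ ≤ (Real.sqrt (∫ x, a x ∂μ) * Real.sqrt (∫ x, b x ∂μ)) ^ 2 :=
        pow_le_pow_left₀ (integral_nonneg fun x => Real.sqrt_nonneg _) (hm.trans hol) 2
    _ = _ := by
      rw [mul_pow, Real.sq_sqrt (integral_nonneg_of_ae ha0),
        Real.sq_sqrt (integral_nonneg_of_ae hb0)]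


/-- Integral Cauchy–Schwarz chain for matrix-valued maps: if `A x`, `G x`, `W x`
are positive definite Hermitian for a.e. `x`, then
`(∫ √(det(G⁻¹A) · tr(G⁻¹W)))² ≤ (∫ tr(A⁻¹W) · det(G⁻¹A)) · (∫ tr(G⁻¹A))`. -/
theorem integral_cauchy_schwarz_chain
    (X : Type*) [MeasurableSpace X] (μ : Measure X) (n : ℕ) (hn : 1 ≤ n)
    (A G W : X → Matrix (Fin n) (Fin n) ℂ)
    (hAm : ∀ i j, Measurable fun x => A x i j)
    (hGm : ∀ i j, Measurable fun x => G x i j)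
    (hWm : ∀ i j, Measurable fun x => W x i j)
    (hA : ∀ᵐ x ∂μ, (A x).PosDef)
    (hG : ∀ᵐ x ∂μ, (G x).PosDef)
    (hW : ∀ᵐ x ∂μ, (W x).PosDef)
    (h1 : Integrable (fun x => (((A x)⁻¹ * W x).trace).re * (((G x)⁻¹ * A x).det).re) μ)
    (h2 : Integrable (fun x => (((G x)⁻¹ * A x).trace).re) μ) :
    (∫ x, Real.sqrt ((((G x)⁻¹ * A x).det).re * (((G x)⁻¹ * W x).trace).re) ∂μ) ^ 2 ≤
      (∫ x, (((A x)⁻¹ * W x).trace).re * (((G x)⁻¹ * A x).det).re ∂μ) *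
        (∫ x, (((G x)⁻¹ * A x).trace).re ∂μ) := by
  refine aux_cs h1 h2 ?_ ?_ ?_
  · filter_upwards [hA, hG, hW] with x a g w
    exact mul_nonneg (aux_point a g w).1 (aux_det a g)
  · filter_upwards [hA, hG, hW] with x a g w
    exact (aux_point a g w).2.1
  · filter_upwards [hA, hG, hW] with x a g w
    have := mul_le_mul_of_nonneg_left (aux_point a g w).2.2 (aux_det a g)
    linarith
end

section
/- Let (X, μ) be a measure space, n ≥ 1, and let B, E : X → Matrix(n, n, ℂ) be measurable maps such that for every x, B(x) is Hermitian and E(x) is positive definite Hermitian. For ε ≥ 0 set S(ε) = {x ∈ X : B(x) + ε·E(x) is positive semidefinite}, and assume each S(ε) is measurable and that the function x ↦ Re(det(B(x) + E(x))) is integrable on X. Then, as ε → 0⁺, the integrals ∫_{S(ε)} Re(det(B(x) + ε·E(x))) dμ converge to ∫_{S(0)} Re(det(B(x))) dμ. -/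
open Matrix MeasureTheory Filter
open scoped ComplexOrder

lemma aux_det_add_smul_one {n : ℕ} {H : Matrix (Fin n) (Fin n) ℂ} (hH : H.PosSemidef)
    {t : ℝ} (ht : 0 ≤ t) : H.det ≤ (H + t • (1 : Matrix (Fin n) (Fin n) ℂ)).det := by
  have h1 : (H + t • (1 : Matrix (Fin n) (Fin n) ℂ)).det
      = ∏ i, (((hH.1.eigenvalues i + t : ℝ)) : ℂ) := by
    have h2 := congrArg (Polynomial.eval (-(t : ℂ))) hH.1.charpoly_eq
    rw [Matrix.eval_charpoly, Polynomial.eval_prod] at h2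
    have h3 : (Matrix.scalar (Fin n) (-(t : ℂ)) - H)
        = -(H + t • (1 : Matrix (Fin n) (Fin n) ℂ)) := by
      ext i j
      by_cases hij : i = j
      · subst hij; simp; ring
      · simp [hij]
    rw [h3, Matrix.det_neg] at h2
    have h4 : ∀ i, Polynomial.eval (-(t : ℂ)) (Polynomial.X - Polynomial.C ((hH.1.eigenvalues i : ℝ) : ℂ))
        = (-1) * (((hH.1.eigenvalues i + t : ℝ)) : ℂ) := by
      intro i; simp; ring
    have h5 : (-1 : ℂ) ^ n * (H + t • (1 : Matrix (Fin n) (Fin n) ℂ)).det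
        = (-1) ^ n * ∏ i, (((hH.1.eigenvalues i + t : ℝ)) : ℂ) := by
      have h6 := h2.trans (Finset.prod_congr rfl fun i _ => h4 i)
      rw [Finset.prod_mul_distrib] at h6
      simpa using h6
    exact mul_left_cancel₀ (pow_ne_zero _ (by norm_num)) h5
  rw [h1, hH.1.det_eq_prod_eigenvalues]
  have : (∏ i, hH.1.eigenvalues i) ≤ ∏ i, (hH.1.eigenvalues i + t) :=
    Finset.prod_le_prod (fun i _ => hH.eigenvalues_nonneg i) (fun i _ => by linarith)
  have h := Complex.real_le_real.2 this
  rw [Complex.ofReal_prod, Complex.ofReal_prod] at h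
  exact h

open scoped MatrixOrder in
lemma aux_det_mono {n : ℕ} {A E : Matrix (Fin n) (Fin n) ℂ} (hA : A.PosSemidef)
    (hE : E.PosDef) {t : ℝ} (ht : 0 ≤ t) : A.det ≤ (A + t • E).det := by
  obtain ⟨y, hy, rfl⟩ := CStarAlgebra.isStrictlyPositive_iff_eq_star_mul_self.mp
        hE.isStrictlyPositive
  have hyd : IsUnit y.det := (Matrix.isUnit_iff_isUnit_det y).1 hy
  have hH := hA.conjTranspose_mul_mul_same y⁻¹
  have key : ∀ s : ℝ, A + s • (star y * y) = yᴴ * ((y⁻¹)ᴴ * A * y⁻¹ + s • 1) * y := by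
    intro s
    have e1 : y⁻¹ * y = 1 := Matrix.nonsing_inv_mul y hyd
    have e2 : yᴴ * (y⁻¹)ᴴ = 1 := by rw [← Matrix.conjTranspose_mul, e1, Matrix.conjTranspose_one]
    rw [mul_add, add_mul, ← mul_assoc, ← mul_assoc, e2, one_mul, mul_assoc, e1, mul_one]
    simp [Matrix.star_eq_conjTranspose]
  have k0 := key 0
  simp only [zero_smul, add_zero] at k0
  rw [key t]
  nth_rewrite 1 [k0]
  simp only [Matrix.det_mul _ y, Matrix.det_mul yᴴ]
  have hm := aux_det_add_smul_one hH ht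
  have hp : 0 ≤ star y.det * y.det := star_mul_self_nonneg _
  rw [Matrix.det_conjTranspose]
  calc _ = star y.det * y.det * ((y⁻¹)ᴴ * A * y⁻¹).det := by ring
    _ ≤ star y.det * y.det * ((y⁻¹)ᴴ * A * y⁻¹ + t • 1).det := mul_le_mul_of_nonneg_left hm hp
    _ = _ := by ring

lemma aux_psd_mono {n : ℕ} {A E : Matrix (Fin n) (Fin n) ℂ} (hA : A.PosSemidef)
    (hE : E.PosDef) {t : ℝ} (ht : 0 ≤ t) : (A + t • E).PosSemidef :=
  hA.add (hE.posSemidef.smul ht)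

lemma aux_cont {n : ℕ} (B E : Matrix (Fin n) (Fin n) ℂ) :
    Continuous fun ε : ℝ => B + ε • E := by fun_prop

lemma aux_psd_limit {n : ℕ} {B E : Matrix (Fin n) (Fin n) ℂ} (hB : B.IsHermitian)
    (h : ∃ᶠ ε : ℝ in nhdsWithin 0 (Set.Ioi 0), (B + ε • E).PosSemidef) : B.PosSemidef := by
  refine .of_dotProduct_mulVec_nonneg hB fun v => ?_
  have hc : Continuous fun ε : ℝ => star v ⬝ᵥ ((B + ε • E) *ᵥ v) := by
    have := aux_cont B E
    fun_prop
  have ht : Tendsto (fun ε : ℝ => star v ⬝ᵥ ((B + ε • E) *ᵥ v)) (nhdsWithin 0 (Set.Ioi 0))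
      (nhds (star v ⬝ᵥ (B *ᵥ v))) := by
    have := hc.tendsto 0
    simp only [zero_smul, add_zero] at this
    exact this.mono_left nhdsWithin_le_nhds
  have hcl : IsClosed {z : ℂ | 0 ≤ z} := isClosed_Ici
  exact hcl.mem_of_frequently_of_tendsto (h.mono fun ε hε => hε.dotProduct_mulVec_nonneg v) ht

/-- Matrix-valued form of the limit
`lim_{ε→0⁺} ∫_{X(β+εω,0)} (β+εω)ⁿ = ∫_{X(β,0)} βⁿ` : with `B x` Hermitian and
`E x` positive definite Hermitian, the integrals of `Re (det (B + ε E))` over the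
sets where `B + ε E` is positive semidefinite converge, as `ε → 0⁺`, to the
integral of `Re (det B)` over the set where `B` is positive semidefinite. -/
theorem tendsto_integral_det_posSemidef_set
    (X : Type*) [MeasurableSpace X] (μ : Measure X) (n : ℕ) (hn : 1 ≤ n)
    (B E : X → Matrix (Fin n) (Fin n) ℂ)
    (hBm : ∀ i j, Measurable fun x => B x i j)
    (hEm : ∀ i j, Measurable fun x => E x i j)
    (hB : ∀ x, (B x).IsHermitian)
    (hE : ∀ x, (E x).PosDef)
    (S : ℝ → Set X)
    (hS : ∀ ε : ℝ, 0 ≤ ε → S ε = {x | (B x + ε • E x).PosSemidef})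
    (hSm : ∀ ε : ℝ, 0 ≤ ε → MeasurableSet (S ε))
    (hint : Integrable (fun x => ((B x + E x).det).re) μ) :
    Tendsto (fun ε : ℝ => ∫ x in S ε, ((B x + ε • E x).det).re ∂μ)
      (nhdsWithin 0 (Set.Ioi 0))
      (nhds (∫ x in S 0, ((B x).det).re ∂μ)) := by
  have hI : ∀ ε : ℝ, 0 ≤ ε → ∫ x in S ε, ((B x + ε • E x).det).re ∂μ
      = ∫ x, (S ε).indicator (fun x => ((B x + ε • E x).det).re) x ∂μ :=
    fun ε hε => (integral_indicator (hSm ε hε)).symm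
  have h0 : ∫ x in S 0, ((B x).det).re ∂μ
      = ∫ x, (S 0).indicator (fun x => ((B x).det).re) x ∂μ :=
    (integral_indicator (hSm 0 le_rfl)).symm
  rw [h0]
  have hpos : ∀ᶠ ε : ℝ in nhdsWithin 0 (Set.Ioi 0), 0 < ε := self_mem_nhdsWithin
  have hle : ∀ᶠ ε : ℝ in nhdsWithin 0 (Set.Ioi 0), ε ≤ 1 :=
    nhdsWithin_le_nhds (Iic_mem_nhds (by norm_num))
  refine Tendsto.congr' (f₁ := fun ε : ℝ =>
    ∫ x, (S ε).indicator (fun x => ((B x + ε • E x).det).re) x ∂μ) ?_ ?_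
  · filter_upwards [hpos] with ε hε using (hI ε hε.le).symm
  refine tendsto_integral_filter_of_dominated_convergence
    (fun x => ‖((B x + E x).det).re‖) ?_ ?_ hint.norm ?_
  · filter_upwards [hpos] with ε hε
    refine (Measurable.indicator ?_ (hSm ε hε.le)).aestronglyMeasurable
    refine Complex.measurable_re.comp ?_
    simp only [Matrix.det_apply]
    refine Finset.measurable_sum _ fun σ _ => Measurable.const_smul
      (Finset.measurable_prod _ fun i _ => ?_) _
    exact (hBm (σ i) i).add ((hEm (σ i) i).const_smul ε)
  · filter_upwards [hpos, hle] with ε hε hε1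
    refine Eventually.of_forall fun x => ?_
    by_cases hx : x ∈ S ε
    · rw [Set.indicator_of_mem hx]
      rw [hS ε hε.le] at hx
      have hx' : (B x + ε • E x).PosSemidef := hx
      have h1 := aux_det_mono hx' (hE x) (sub_nonneg.2 hε1)
      rw [add_assoc, ← add_smul, add_sub_cancel, one_smul] at h1
      have h2 := (Complex.le_def.1 h1).1
      have h3 : 0 ≤ (B x + ε • E x).det.re := (Complex.le_def.1 hx'.det_nonneg).1
      rw [Real.norm_of_nonneg h3]
      exact h2.trans (Real.le_norm_self _)
    · rw [Set.indicator_of_notMem hx]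
      simp
  · refine Eventually.of_forall fun x => ?_
    by_cases hx : x ∈ S 0
    · rw [Set.indicator_of_mem hx]
      rw [hS 0 le_rfl] at hx
      have hx' : (B x).PosSemidef := by simpa using hx
      have hc : Continuous fun ε : ℝ => ((B x + ε • E x).det).re :=
        Complex.continuous_re.comp (aux_cont _ _).matrix_det
      have ht := hc.tendsto 0
      simp only [zero_smul, add_zero] at ht
      refine (ht.mono_left nhdsWithin_le_nhds).congr' ?_
      filter_upwards [hpos] with ε hε
      rw [Set.indicator_of_mem]
      rw [hS ε hε.le]
      exact aux_psd_mono hx' (hE x) hε.le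
    · rw [Set.indicator_of_notMem hx]
      have hev : ∀ᶠ ε : ℝ in nhdsWithin 0 (Set.Ioi 0), ¬ (B x + ε • E x).PosSemidef := by
        by_contra hcon
        apply hx
        rw [hS 0 le_rfl]
        simpa using aux_psd_limit (hB x) hcon
      refine tendsto_const_nhds.congr' ?_
      filter_upwards [hpos, hev] with ε hε hne
      rw [Set.indicator_of_notMem]
      rw [hS ε hε.le]
      exact hne
end
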